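/- (Euclidean instance of the paper's main rate theorem for Hadamard manifolds, with M = ℝ^k a flat, complete, simply connected manifold of nonpositive curvature.) Fix k ≥ 1 and constants C, β, ζ > 0 and 0 < c_1 ≤ c_2. For each n ≥ 2 let t_i = (i−1)/(n−1) for i = 1, …, n, and let λ_n satisfy c_1 n^{-2/3} ≤ λ_n ≤ c_2 n^{-2/3}. Let ℱ_n be the collection of joint distributions of independent ℝ^k-valued random vectors Y_1, …, Y_n for which there exists a function μ : [0,1] → ℝ^k with TV(μ) ≤ C such that for every i: E Y_i = μ(t_i) (so μ(t_i) is the minimizer of y ↦ E‖y − Y_i‖²) and E exp(β ‖Y_i − μ(t_i)‖²) ≤ ζ. Let μ̂_n denote any minimizer of the total variation penalized loss L_{λ_n}(g) = (1/n) Σ_{i=1}^n ‖g(t_i) − Y_i‖² + λ_n TV(g) over functions g : [0,1] → ℝ^k of finite total variation. Then lim_{D → ∞} limsup_{n → ∞} sup_{F ∈ ℱ_n} P_F( d_n(μ̂_n, μ) > D n^{-1/3} ) = 0, where d_n(μ̂_n, μ) = ((1/n) Σ_{i=1}^n ‖μ̂_n(t_i) − μ(t_i)‖²)^{1/2}. 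-/

import Mathlib

open Set MeasureTheory Filter
open scoped ENNReal

/-- Total variation of a function over the interval `[0,1]`:
the supremum over finite monotone sequences in `[0,1]` of the sums of
consecutive distances. -/
noncomputable def TV {M : Type*} [PseudoEMetricSpace M] (g : ℝ → M) : ℝ≥0∞ :=
  eVariationOn g (Set.Icc 0 1)

/-- The equispaced design points `t_i = (i-1)/(n-1)`, `i = 1, …, n`, written with
0-based indices `i : Fin n` as `t_i = i/(n-1)`. -/
noncomputable def design (n : ℕ) (i : Fin n) : ℝ := (i : ℝ) / ((n : ℝ) - 1)

/-- The total variation penalized loss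
`L_λ(g) = (1/n) ∑ᵢ ‖g(tᵢ) - Yᵢ‖² + λ TV(g)` for the equispaced design. -/
noncomputable def Lloss (k n : ℕ) (lam : ℝ) (y : Fin n → EuclideanSpace ℝ (Fin k))
    (g : ℝ → EuclideanSpace ℝ (Fin k)) : ℝ :=
  (1 / (n : ℝ)) * ∑ i, ‖g (design n i) - y i‖ ^ 2 + lam * (TV g).toReal

/-- The empirical pseudo-metric for the equispaced design:
`d_n(f,g) = ((1/n) ∑ᵢ ‖f(tᵢ) - g(tᵢ)‖²)^{1/2}`. -/
noncomputable def dn (k n : ℕ) (f g : ℝ → EuclideanSpace ℝ (Fin k)) : ℝ :=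
  Real.sqrt ((1 / (n : ℝ)) * ∑ i : Fin n, ‖f (design n i) - g (design n i)‖ ^ 2)

/-- Membership of a joint distribution `ν` on `(ℝᵏ)ⁿ`, together with a witness mean
function `μf : [0,1] → ℝᵏ`, in the family `ℱ_n = ℱ_n(C, β, ζ)`: the coordinates
`Y_1, …, Y_n` are independent (`ν` is a product measure), `TV(μf) ≤ C`,
`E Y_i = μf(t_i)` for all `i`, and `E exp(β ‖Y_i - μf(t_i)‖²) ≤ ζ` for all `i`. -/
def InFamily (k : ℕ) (C β ζ : ℝ) (n : ℕ)
    (ν : Measure (Fin n → EuclideanSpace ℝ (Fin k)))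
    (μf : ℝ → EuclideanSpace ℝ (Fin k)) : Prop :=
  TV μf ≤ ENNReal.ofReal C ∧
  ∃ νi : Fin n → ProbabilityMeasure (EuclideanSpace ℝ (Fin k)),
    ν = Measure.pi (fun i => (νi i : Measure (EuclideanSpace ℝ (Fin k)))) ∧
    (∀ i, Integrable (fun y => y) (νi i : Measure (EuclideanSpace ℝ (Fin k))) ∧
      (∫ y, y ∂(νi i : Measure (EuclideanSpace ℝ (Fin k)))) = μf (design n i)) ∧
    (∀ i, (∫⁻ y, ENNReal.ofReal (Real.exp (β * ‖y - μf (design n i)‖ ^ 2))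
        ∂(νi i : Measure (EuclideanSpace ℝ (Fin k)))) ≤ ENNReal.ofReal ζ)


lemma exp_le_add_exp_sq (x : ℝ) : Real.exp x ≤ x + Real.exp (x ^ 2) := by
  have h2 := Real.add_one_le_exp (x ^ 2)
  by_cases h : |x| ≤ 1
  · have := Real.abs_exp_sub_one_sub_id_le h
    have := (abs_le.mp this).2
    linarith
  · rw [not_le, lt_abs] at h
    rcases h with h | h
    · have : Real.exp x ≤ Real.exp (x ^ 2) := Real.exp_le_exp.mpr (by nlinarith)
      linarith
    · have : Real.exp x ≤ 1 := Real.exp_le_one_iff.mpr (by linarith)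
      nlinarith

noncomputable def topc (s t : ℕ) (f : ℕ → ℝ) : ℝ :=
  ∑ i ∈ Finset.Ico s t, (1 / √((t : ℝ) - s)) * f i

noncomputable def haarw (s t u : ℕ) (i : ℕ) : ℝ :=
  if i < t then √(((t : ℝ) - s) * (u - t) / (u - s)) / (t - s)
  else - (√(((t : ℝ) - s) * (u - t) / (u - s)) / (u - t))

noncomputable def haarc (s t u : ℕ) (f : ℕ → ℝ) : ℝ :=
  ∑ i ∈ Finset.Ico s u, haarw s t u i * f i

lemma topc_mul (s t : ℕ) (hst : s ≤ t) (e x : ℕ → ℝ) :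
    topc s t e * topc s t x =
      (∑ i ∈ Finset.Ico s t, e i) * (∑ i ∈ Finset.Ico s t, x i) / ((t : ℝ) - s) := by
  unfold topc
  rw [← Finset.mul_sum, ← Finset.mul_sum]
  have h : (0 : ℝ) ≤ t - s := by
    have : (s : ℝ) ≤ t := by exact_mod_cast hst
    linarith
  have h2 : (1 / √((t : ℝ) - s)) * (1 / √((t : ℝ) - s)) = 1 / ((t : ℝ) - s) := by
    rw [div_mul_div_comm, Real.mul_self_sqrt h, one_mul]
  calc _ = ((1 / √((t : ℝ) - s)) * (1 / √((t : ℝ) - s))) *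
      ((∑ i ∈ Finset.Ico s t, e i) * (∑ i ∈ Finset.Ico s t, x i)) := by ring
    _ = _ := by rw [h2]; ring

lemma haarc_eq (s t u : ℕ) (hst : s ≤ t) (htu : t ≤ u) (f : ℕ → ℝ) :
    haarc s t u f = √(((t : ℝ) - s) * (u - t) / (u - s)) *
      ((∑ i ∈ Finset.Ico s t, f i) / (t - s) - (∑ i ∈ Finset.Ico t u, f i) / (u - t)) := by
  unfold haarc
  rw [← Finset.sum_Ico_consecutive _ hst htu]
  have h1 : ∑ i ∈ Finset.Ico s t, haarw s t u i * f i =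
      ∑ i ∈ Finset.Ico s t, √(((t : ℝ) - s) * (u - t) / (u - s)) / (t - s) * f i := by
    refine Finset.sum_congr rfl fun i hi => ?_
    rw [Finset.mem_Ico] at hi
    simp [haarw, hi.2]
  have h2 : ∑ i ∈ Finset.Ico t u, haarw s t u i * f i =
      ∑ i ∈ Finset.Ico t u, - (√(((t : ℝ) - s) * (u - t) / (u - s)) / (u - t)) * f i := by
    refine Finset.sum_congr rfl fun i hi => ?_
    rw [Finset.mem_Ico] at hi
    simp [haarw, hi.1]
  rw [h1, h2, ← Finset.mul_sum, ← Finset.mul_sum]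
  ring

lemma haarw_sq (s t u : ℕ) (hst : s ≤ t) (htu : t ≤ u) :
    ∑ i ∈ Finset.Ico s u, haarw s t u i ^ 2 ≤ 1 := by
  have ha : (s : ℝ) ≤ t := by exact_mod_cast hst
  have hb : (t : ℝ) ≤ u := by exact_mod_cast htu
  have hk : (0 : ℝ) ≤ ((t : ℝ) - s) * (u - t) / (u - s) :=
    div_nonneg (mul_nonneg (by linarith) (by linarith)) (by linarith)
  rw [← Finset.sum_Ico_consecutive _ hst htu]
  have h1 : ∑ i ∈ Finset.Ico s t, haarw s t u i ^ 2 =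
      ∑ i ∈ Finset.Ico s t, (((t : ℝ) - s) * (u - t) / (u - s)) / (t - s) ^ 2 := by
    refine Finset.sum_congr rfl fun i hi => ?_
    rw [Finset.mem_Ico] at hi
    simp only [haarw, hi.2, if_true]
    rw [div_pow, Real.sq_sqrt hk]
  have h2 : ∑ i ∈ Finset.Ico t u, haarw s t u i ^ 2 =
      ∑ i ∈ Finset.Ico t u, (((t : ℝ) - s) * (u - t) / (u - s)) / (u - t) ^ 2 := by
    refine Finset.sum_congr rfl fun i hi => ?_
    rw [Finset.mem_Ico] at hi
    simp only [haarw, not_lt.mpr hi.1, if_false]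
    rw [neg_sq, div_pow, Real.sq_sqrt hk]
  rw [h1, h2, Finset.sum_const, Finset.sum_const, Nat.card_Ico, Nat.card_Ico, nsmul_eq_mul,
    nsmul_eq_mul, Nat.cast_sub hst, Nat.cast_sub htu]
  rcases hst.eq_or_lt with h | h
  · subst h; simp
  rcases htu.eq_or_lt with h' | h'
  · subst h'; simp
  have ha' : (s : ℝ) < t := by exact_mod_cast h
  have hb' : (t : ℝ) < u := by exact_mod_cast h'
  have e1 : (t : ℝ) - s ≠ 0 := by linarith
  have e2 : (u : ℝ) - t ≠ 0 := by linarith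
  have e3 : (u : ℝ) - s ≠ 0 := by linarith
  apply le_of_eq
  field_simp
  ring

lemma topw_sq (s t : ℕ) (hst : s ≤ t) :
    ∑ _i ∈ Finset.Ico s t, (1 / √((t : ℝ) - s)) ^ 2 ≤ 1 := by
  have ha : (s : ℝ) ≤ t := by exact_mod_cast hst
  rw [Finset.sum_const, Nat.card_Ico, nsmul_eq_mul, Nat.cast_sub hst, div_pow,
    Real.sq_sqrt (by linarith), one_pow, mul_one_div]
  exact div_self_le_one _

lemma split_id (s t u : ℕ) (hst : s ≤ t) (htu : t ≤ u) (e x : ℕ → ℝ) :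
    topc s t e * topc s t x + topc t u e * topc t u x =
      topc s u e * topc s u x + haarc s t u e * haarc s t u x := by
  have ha : (s : ℝ) ≤ t := by exact_mod_cast hst
  have hb : (t : ℝ) ≤ u := by exact_mod_cast htu
  have hk : (0 : ℝ) ≤ ((t : ℝ) - s) * (u - t) / (u - s) :=
    div_nonneg (mul_nonneg (by linarith) (by linarith)) (by linarith)
  rw [topc_mul _ _ hst, topc_mul _ _ htu, topc_mul _ _ (hst.trans htu), haarc_eq _ _ _ hst htu,
    haarc_eq _ _ _ hst htu, mul_mul_mul_comm, Real.mul_self_sqrt hk,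
    ← Finset.sum_Ico_consecutive e hst htu, ← Finset.sum_Ico_consecutive x hst htu]
  rcases hst.eq_or_lt with h | h
  · subst h; simp
  rcases htu.eq_or_lt with h' | h'
  · subst h'; simp
  have ha' : (s : ℝ) < t := by exact_mod_cast h
  have hb' : (t : ℝ) < u := by exact_mod_cast h'
  have e1 : (t : ℝ) - s ≠ 0 := by linarith
  have e2 : (u : ℝ) - t ≠ 0 := by linarith
  have e3 : (u : ℝ) - s ≠ 0 := by linarith
  field_simp
  ring

/-- distance between two values is at most the variation -/
lemma abs_sub_le_var (x : ℕ → ℝ) (s u i j : ℕ) (hi : i ∈ Finset.Ico s u)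
    (hj : j ∈ Finset.Ico s u) : |x i - x j| ≤ ∑ l ∈ Finset.Ico s u, |x (l + 1) - x l| := by
  wlog hij : i ≤ j generalizing i j
  · rw [abs_sub_comm]; exact this j i hj hi (by omega)
  rw [Finset.mem_Ico] at hi hj
  have h1 : x j - x i = ∑ l ∈ Finset.Ico i j, (x (l + 1) - x l) := by
    rw [Finset.sum_Ico_sub (fun l => x l) hij]
  rw [abs_sub_comm, h1]
  refine (Finset.abs_sum_le_sum_abs _ _).trans ?_
  refine Finset.sum_le_sum_of_subset_of_nonneg ?_ (fun _ _ _ => abs_nonneg _)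
  intro l hl
  rw [Finset.mem_Ico] at hl ⊢
  omega

lemma haarc_le (s t u : ℕ) (hst : s ≤ t) (htu : t ≤ u) (x : ℕ → ℝ) (L : ℝ)
    (hL : (t : ℝ) - s ≤ L) :
    |haarc s t u x| ≤ √L * ∑ l ∈ Finset.Ico s u, |x (l + 1) - x l| := by
  have hV : 0 ≤ ∑ l ∈ Finset.Ico s u, |x (l + 1) - x l| :=
    Finset.sum_nonneg fun _ _ => abs_nonneg _
  rw [haarc_eq _ _ _ hst htu]
  rcases hst.eq_or_lt with h | h
  · subst h; simp; positivity
  rcases htu.eq_or_lt with h' | h'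
  · subst h'; simp; positivity
  have ha' : (s : ℝ) < t := by exact_mod_cast h
  have hb' : (t : ℝ) < u := by exact_mod_cast h'
  rw [abs_mul, abs_of_nonneg (Real.sqrt_nonneg _)]
  apply mul_le_mul _ _ (abs_nonneg _) (Real.sqrt_nonneg _)
  · apply Real.sqrt_le_sqrt
    rw [div_le_iff₀ (by linarith)]
    nlinarith
  · have e1 : (t : ℝ) - s ≠ 0 := by linarith
    have e2 : (u : ℝ) - t ≠ 0 := by linarith
    have key : (∑ i ∈ Finset.Ico s t, x i) / ((t : ℝ) - s) - (∑ i ∈ Finset.Ico t u, x i) / (u - t)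
        = (∑ i ∈ Finset.Ico s t, ∑ j ∈ Finset.Ico t u, (x i - x j)) / (((t : ℝ) - s) * (u - t)) := by
      simp only [Finset.sum_sub_distrib, Finset.sum_const, Nat.card_Ico, nsmul_eq_mul,
        Nat.cast_sub hst, Nat.cast_sub htu, ← Finset.mul_sum]
      field_simp
    rw [key, abs_div, abs_of_pos (show 0 < ((t : ℝ) - s) * (u - t) from
      mul_pos (by linarith) (by linarith)), div_le_iff₀ (mul_pos (by linarith) (by linarith))]
    refine (Finset.abs_sum_le_sum_abs _ _).trans ?_
    have : ∀ i ∈ Finset.Ico s t, |∑ j ∈ Finset.Ico t u, (x i - x j)| ≤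
        ((u : ℝ) - t) * ∑ l ∈ Finset.Ico s u, |x (l + 1) - x l| := by
      intro i hi
      refine (Finset.abs_sum_le_sum_abs _ _).trans ?_
      refine (Finset.sum_le_card_nsmul _ _ (∑ l ∈ Finset.Ico s u, |x (l + 1) - x l|) ?_).trans ?_
      · intro j hj
        rw [Finset.mem_Ico] at hi hj
        exact abs_sub_le_var x s u i j (by rw [Finset.mem_Ico]; omega) (by rw [Finset.mem_Ico]; omega)
      · rw [Nat.card_Ico, nsmul_eq_mul, Nat.cast_sub htu]
    refine (Finset.sum_le_card_nsmul _ _ _ this).trans (le_of_eq ?_)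
    rw [Nat.card_Ico, nsmul_eq_mul, Nat.cast_sub hst]
    ring

/-- block boundaries -/
def bd (n m q : ℕ) : ℕ := min (q * 2 ^ m) n

lemma bd_mono (n m : ℕ) : Monotone (bd n m) := fun _ _ h =>
  min_le_min_right _ (Nat.mul_le_mul_right _ h)

lemma bd_succ (n m q : ℕ) : bd n (m + 1) q = bd n m (2 * q) := by
  unfold bd; congr 1; ring

noncomputable def tb (n m q : ℕ) (f : ℕ → ℝ) : ℝ := topc (bd n m q) (bd n m (q + 1)) f

noncomputable def hb (n m q : ℕ) (f : ℕ → ℝ) : ℝ :=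
  haarc (bd n m (2 * q)) (bd n m (2 * q + 1)) (bd n m (2 * q + 2)) f

lemma sum_range_two_mul (Q : ℕ) (f : ℕ → ℝ) :
    ∑ q ∈ Finset.range (2 * Q), f q = ∑ q ∈ Finset.range Q, (f (2 * q) + f (2 * q + 1)) := by
  induction Q with
  | zero => simp
  | succ Q ih =>
    rw [show 2 * (Q + 1) = 2 * Q + 1 + 1 by ring, Finset.sum_range_succ, Finset.sum_range_succ, ih,
      Finset.sum_range_succ]
    ring

lemma sum_blocks (c : ℕ → ℕ) (hc : Monotone c) (Q : ℕ) (f : ℕ → ℝ) :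
    ∑ q ∈ Finset.range Q, ∑ i ∈ Finset.Ico (c q) (c (q + 1)), f i =
      ∑ i ∈ Finset.Ico (c 0) (c Q), f i := by
  induction Q with
  | zero => simp
  | succ Q ih =>
    rw [Finset.sum_range_succ, ih, Finset.sum_Ico_consecutive _ (hc (Nat.zero_le _))
      (hc (Nat.le_succ _))]

lemma decomp (n : ℕ) (e x : ℕ → ℝ) (M : ℕ) : ∀ Q : ℕ, n ≤ Q * 2 ^ M →
    ∑ i ∈ Finset.range n, e i * x i = ∑ q ∈ Finset.range Q, tb n M q e * tb n M q x +
      ∑ m ∈ Finset.range M, ∑ q ∈ Finset.range (Q * 2 ^ (M - 1 - m)), hb n m q e * hb n m q x := by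
  induction M with
  | zero =>
    intro Q hQ
    rw [pow_zero, mul_one] at hQ
    have h1 : ∀ q ∈ Finset.range Q, tb n 0 q e * tb n 0 q x =
        ∑ i ∈ Finset.Ico (bd n 0 q) (bd n 0 (q+1)), e i * x i := by
      intro q _
      unfold tb
      rw [topc_mul _ _ (bd_mono n 0 (Nat.le_succ q))]
      unfold bd
      simp only [pow_zero, mul_one]
      rcases lt_or_ge q n with h | h
      · rw [min_eq_left h.le, min_eq_left (show q + 1 ≤ n from h)]
        simp
      · rw [min_eq_right h, min_eq_right (show n ≤ q + 1 by omega)]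
        simp
    rw [Finset.sum_congr rfl h1, sum_blocks _ (bd_mono n 0)]
    rw [Finset.range_eq_Ico]
    have e1 : bd n 0 0 = 0 := by simp [bd]
    have e2 : bd n 0 Q = n := by simp [bd, hQ]
    rw [e1, e2]
    simp
  | succ M ih =>
    intro Q hQ
    rw [ih (2 * Q) (by rw [pow_succ] at hQ; linarith), sum_range_two_mul, Finset.sum_range_succ,
      show M + 1 - 1 - M = 0 by omega, pow_zero, mul_one]
    have h1 : ∀ q ∈ Finset.range Q, (tb n M (2 * q) e * tb n M (2 * q) x +
        tb n M (2 * q + 1) e * tb n M (2 * q + 1) x) =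
        tb n (M + 1) q e * tb n (M + 1) q x + hb n M q e * hb n M q x := by
      intro q _
      unfold tb hb
      rw [split_id _ _ _ (bd_mono n M (Nat.le_succ _)) (bd_mono n M (Nat.le_succ _)), bd_succ,
        bd_succ]
      rfl
    rw [Finset.sum_congr rfl h1, Finset.sum_add_distrib]
    have h2 : ∀ m ∈ Finset.range M, 2 * Q * 2 ^ (M - 1 - m) = Q * 2 ^ (M + 1 - 1 - m) := by
      intro m hm
      rw [Finset.mem_range] at hm
      rw [show M + 1 - 1 - m = (M - 1 - m) + 1 by omega]
      ring
    have h3 : ∑ m ∈ Finset.range M, ∑ q ∈ Finset.range (2 * Q * 2 ^ (M - 1 - m)),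
        hb n m q e * hb n m q x = ∑ m ∈ Finset.range M,
        ∑ q ∈ Finset.range (Q * 2 ^ (M + 1 - 1 - m)), hb n m q e * hb n m q x :=
      Finset.sum_congr rfl fun m hm => by rw [h2 m hm]
    rw [h3]
    ring

lemma geom_bound (M : ℕ) :
    ∑ m ∈ Finset.range M, (6 / 5 : ℝ) ^ (M - m) * √(2 ^ m) ≤ 6 * √(2 ^ M) := by
  induction M with
  | zero => simp
  | succ M ih =>
    rw [Finset.sum_range_succ]
    have h1 : ∑ m ∈ Finset.range M, (6 / 5 : ℝ) ^ (M + 1 - m) * √(2 ^ m) =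
        (6 / 5) * ∑ m ∈ Finset.range M, (6 / 5 : ℝ) ^ (M - m) * √(2 ^ m) := by
      rw [Finset.mul_sum]
      refine Finset.sum_congr rfl fun m hm => ?_
      rw [Finset.mem_range] at hm
      rw [show M + 1 - m = (M - m) + 1 by omega]
      ring
    rw [h1, show M + 1 - M = 1 by omega, pow_succ (2 : ℝ) M, Real.sqrt_mul (by positivity)]
    have h2 : (1.4 : ℝ) ≤ √2 := Real.le_sqrt_of_sq_le (by norm_num)
    have h3 : 0 ≤ √((2 : ℝ) ^ M) := Real.sqrt_nonneg _
    nlinarith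

noncomputable def R2 (n M Q : ℕ) (e : ℕ → ℝ) : ℝ :=
  ∑ q ∈ Finset.range Q, tb n M q e ^ 2 + ∑ m ∈ Finset.range M,
    ∑ q ∈ Finset.range (Q * 2 ^ (M - 1 - m)), hb n m q e ^ 10 / ((6 / 5 : ℝ) ^ (M - m)) ^ 8

lemma term_bound (w d τ : ℝ) (hτ : 0 < τ) :
    2 * (w * d) ≤ 2 * (τ * |d|) + d ^ 2 / 2 + 2 * (w ^ 10 / τ ^ 8) := by
  have h1 : w * d ≤ |w| * |d| := by rw [← abs_mul]; exact le_abs_self _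
  by_cases h : |w| ≤ τ
  · have : |w| * |d| ≤ τ * |d| := mul_le_mul_of_nonneg_right h (abs_nonneg _)
    have : 0 ≤ w ^ 10 / τ ^ 8 := div_nonneg (Even.pow_nonneg (by decide) _) (by positivity)
    nlinarith [sq_nonneg d]
  · push Not at h
    have h2 : w ^ 2 ≤ w ^ 10 / τ ^ 8 := by
      rw [le_div_iff₀ (by positivity)]
      have : τ ^ 8 ≤ |w| ^ 8 := pow_le_pow_left₀ hτ.le h.le 8
      rw [Even.pow_abs (by decide)] at this
      nlinarith [sq_nonneg w]
    have : 0 ≤ τ * |d| := by positivity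
    nlinarith [sq_nonneg (d - 2 * w)]

lemma det_bound (n M Q : ℕ) (hQ : n ≤ Q * 2 ^ M) (e x : ℕ → ℝ) :
    2 * ∑ i ∈ Finset.range n, e i * x i ≤
      12 * √(2 ^ M) * (∑ l ∈ Finset.range n, |x (l + 1) - x l|) +
      (∑ i ∈ Finset.range n, x i ^ 2) / 2 + 2 * R2 n M Q e := by
  set V := ∑ l ∈ Finset.range n, |x (l + 1) - x l| with hV
  have hV0 : 0 ≤ V := Finset.sum_nonneg fun _ _ => abs_nonneg _
  have hx : ∑ i ∈ Finset.range n, x i ^ 2 = ∑ q ∈ Finset.range Q, tb n M q x ^ 2 +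
      ∑ m ∈ Finset.range M, ∑ q ∈ Finset.range (Q * 2 ^ (M - 1 - m)), hb n m q x ^ 2 := by
    simp only [pow_two (x _), pow_two (tb _ _ _ _), pow_two (hb _ _ _ _)]
    exact decomp n x x M Q hQ
  rw [decomp n e x M Q hQ, hx]
  have hlev : ∀ m ∈ Finset.range M, ∑ q ∈ Finset.range (Q * 2 ^ (M - 1 - m)), |hb n m q x| ≤
      √(2 ^ m) * V := by
    intro m hm
    rw [Finset.mem_range] at hm
    have h1 : ∀ q ∈ Finset.range (Q * 2 ^ (M - 1 - m)), |hb n m q x| ≤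
        √(2 ^ m) * ∑ l ∈ Finset.Ico (bd n (m + 1) q) (bd n (m + 1) (q + 1)), |x (l + 1) - x l| := by
      intro q _
      rw [bd_succ, bd_succ]
      refine haarc_le _ _ _ (bd_mono n m (Nat.le_succ _)) (bd_mono n m (Nat.le_succ _)) x _ ?_
      rw [sub_le_iff_le_add]
      have : bd n m (2 * q + 1) ≤ 2 ^ m + bd n m (2 * q) := by
        unfold bd
        rw [Nat.add_mul, one_mul]
        generalize 2 * q * 2 ^ m = a
        generalize 2 ^ m = b
        omega
      exact_mod_cast this
    refine (Finset.sum_le_sum h1).trans ?_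
    rw [← Finset.mul_sum, sum_blocks _ (bd_mono n (m + 1))]
    refine mul_le_mul_of_nonneg_left ?_ (Real.sqrt_nonneg _)
    refine Finset.sum_le_sum_of_subset_of_nonneg ?_ (fun _ _ _ => abs_nonneg _)
    intro l hl
    simp only [Finset.mem_Ico, bd] at hl
    rw [Finset.mem_range]
    omega
  have htop : 2 * ∑ q ∈ Finset.range Q, tb n M q e * tb n M q x ≤
      (∑ q ∈ Finset.range Q, tb n M q x ^ 2) / 2 + 2 * ∑ q ∈ Finset.range Q, tb n M q e ^ 2 := by
    rw [Finset.mul_sum, Finset.mul_sum, Finset.sum_div, ← Finset.sum_add_distrib]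
    refine Finset.sum_le_sum fun q _ => ?_
    nlinarith [sq_nonneg (tb n M q x - 2 * tb n M q e)]
  have hh : ∀ m ∈ Finset.range M,
      2 * ∑ q ∈ Finset.range (Q * 2 ^ (M - 1 - m)), hb n m q e * hb n m q x ≤
      2 * V * ((6 / 5 : ℝ) ^ (M - m) * √(2 ^ m)) +
      (∑ q ∈ Finset.range (Q * 2 ^ (M - 1 - m)), hb n m q x ^ 2) / 2 +
      2 * ∑ q ∈ Finset.range (Q * 2 ^ (M - 1 - m)),
        hb n m q e ^ 10 / ((6 / 5 : ℝ) ^ (M - m)) ^ 8 := by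
    intro m hm
    have h0 : (0 : ℝ) < (6 / 5 : ℝ) ^ (M - m) := by positivity
    have h1 : 2 * ∑ q ∈ Finset.range (Q * 2 ^ (M - 1 - m)), hb n m q e * hb n m q x ≤
      2 * ((6 / 5 : ℝ) ^ (M - m) * ∑ q ∈ Finset.range (Q * 2 ^ (M - 1 - m)), |hb n m q x|) +
      (∑ q ∈ Finset.range (Q * 2 ^ (M - 1 - m)), hb n m q x ^ 2) / 2 +
      2 * ∑ q ∈ Finset.range (Q * 2 ^ (M - 1 - m)),
        hb n m q e ^ 10 / ((6 / 5 : ℝ) ^ (M - m)) ^ 8 := by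
      simp only [Finset.mul_sum, Finset.sum_div, ← Finset.sum_add_distrib]
      exact Finset.sum_le_sum fun q _ => term_bound _ _ _ h0
    have h2 := mul_le_mul_of_nonneg_left (hlev m hm) h0.le
    linarith
  have hs := Finset.sum_le_sum hh
  rw [Finset.sum_add_distrib, Finset.sum_add_distrib, ← Finset.mul_sum, ← Finset.mul_sum,
    ← Finset.mul_sum, ← Finset.sum_div] at hs
  have hg := mul_le_mul_of_nonneg_left (geom_bound M) (show 0 ≤ 2 * V by linarith)
  unfold R2
  linarith

lemma exp_pt (β h g : ℝ) (hβ : 0 < β) (hh : h ^ 2 ≤ 1) :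
    Real.exp (√β * (h * g)) ≤ √β * h * g + (1 - h ^ 2) + h ^ 2 * Real.exp (β * g ^ 2) := by
  have h1 := exp_le_add_exp_sq (√β * (h * g))
  have h2 : (√β * (h * g)) ^ 2 = (1 - h ^ 2) * 0 + h ^ 2 * (β * g ^ 2) := by
    rw [mul_pow, Real.sq_sqrt hβ.le]; ring
  have h3 := convexOn_exp.2 (Set.mem_univ (0 : ℝ)) (Set.mem_univ (β * g ^ 2))
    (show 0 ≤ 1 - h ^ 2 by linarith) (sq_nonneg h) (by ring)
  simp only [smul_eq_mul, Real.exp_zero, mul_one] at h3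
  rw [h2] at h1
  simp only [mul_zero] at h1 h3
  linarith

lemma exp_one {X : Type*} [MeasurableSpace X] (P : Measure X) [MeasureTheory.IsProbabilityMeasure P]
    (g : X → ℝ) (hg : Integrable g P) (hg0 : ∫ x, g x ∂P = 0) (β ζ h : ℝ) (hβ : 0 < β)
    (hh : h ^ 2 ≤ 1) (hI : Integrable (fun x => Real.exp (β * g x ^ 2)) P)
    (hζ : ∫ x, Real.exp (β * g x ^ 2) ∂P ≤ ζ) :
    Integrable (fun x => Real.exp (√β * (h * g x))) P ∧
      ∫ x, Real.exp (√β * (h * g x)) ∂P ≤ Real.exp (h ^ 2 * ζ) := by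
  have hdom : Integrable
      (fun x => √β * h * g x + (1 - h ^ 2) + h ^ 2 * Real.exp (β * g x ^ 2)) P :=
    ((hg.const_mul _).add (integrable_const _)).add (hI.const_mul _)
  have hint : Integrable (fun x => Real.exp (√β * (h * g x))) P := by
    refine hdom.mono' ?_ ?_
    · exact Real.continuous_exp.comp_aestronglyMeasurable
        ((hg.aestronglyMeasurable.const_mul h).const_mul _)
    · filter_upwards with x
      rw [Real.norm_eq_abs, abs_of_pos (Real.exp_pos _)]
      exact exp_pt β h (g x) hβ hh
  refine ⟨hint, ?_⟩
  have h1 := integral_mono hint hdom (fun x => exp_pt β h (g x) hβ hh)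
  have h2 : ∫ x, (√β * h * g x + (1 - h ^ 2) + h ^ 2 * Real.exp (β * g x ^ 2)) ∂P =
      (1 - h ^ 2) + h ^ 2 * ∫ x, Real.exp (β * g x ^ 2) ∂P := by
    have ia : Integrable (fun x => √β * h * g x + (1 - h ^ 2)) P :=
      (hg.const_mul _).add (integrable_const _)
    rw [integral_add ia (hI.const_mul _),
      integral_add (hg.const_mul _) (integrable_const _), integral_const_mul, integral_const_mul,
      hg0]
    simp
  rw [h2] at h1
  have h3 := Real.add_one_le_exp (h ^ 2 * ζ)
  nlinarith [sq_nonneg h, mul_le_mul_of_nonneg_left hζ (sq_nonneg h)]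

lemma exp_prod {X : Type*} [MeasurableSpace X] {n : ℕ} (P : Fin n → Measure X)
    [∀ i, MeasureTheory.IsProbabilityMeasure (P i)]
    (g : Fin n → X → ℝ) (hg : ∀ i, Integrable (g i) (P i)) (hg0 : ∀ i, ∫ x, g i x ∂(P i) = 0)
    (β ζ : ℝ) (h : Fin n → ℝ) (hβ : 0 < β) (hζ0 : 0 < ζ)
    (hh : ∑ i, h i ^ 2 ≤ 1) (hI : ∀ i, Integrable (fun x => Real.exp (β * g i x ^ 2)) (P i))
    (hζ : ∀ i, ∫ x, Real.exp (β * g i x ^ 2) ∂(P i) ≤ ζ) :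
    Integrable (fun y : Fin n → X => Real.exp (√β * ∑ i, h i * g i (y i))) (Measure.pi P) ∧
      ∫ y, Real.exp (√β * ∑ i, h i * g i (y i)) ∂(Measure.pi P) ≤ Real.exp ζ := by
  have hi : ∀ i, h i ^ 2 ≤ 1 := fun i =>
    (Finset.single_le_sum (f := fun i => h i ^ 2) (fun j _ => sq_nonneg (h j))
      (Finset.mem_univ i)).trans hh
  have h1 := fun i => exp_one (P i) (g i) (hg i) (hg0 i) β ζ (h i) hβ (hi i) (hI i) (hζ i)
  have e : (fun y : Fin n → X => Real.exp (√β * ∑ i, h i * g i (y i))) =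
      fun y => ∏ i, Real.exp (√β * (h i * g i (y i))) := by
    funext y
    rw [← Real.exp_sum, Finset.mul_sum]
  rw [e]
  refine ⟨Integrable.fintype_prod (f := fun i x => Real.exp (√β * (h i * g i x)))
    fun i => (h1 i).1, ?_⟩
  rw [integral_fintype_prod_eq_prod (f := fun i x => Real.exp (√β * (h i * g i x)))]
  calc _ ≤ ∏ i, Real.exp (h i ^ 2 * ζ) :=
        Finset.prod_le_prod (fun i _ => integral_nonneg fun x => (Real.exp_pos _).le)
          (fun i _ => (h1 i).2)
    _ = Real.exp ((∑ i, h i ^ 2) * ζ) := by rw [← Real.exp_sum, Finset.sum_mul]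
    _ ≤ _ := Real.exp_le_exp.mpr (by nlinarith)

noncomputable def Mu (β ζ : ℝ) : ℝ := (Nat.factorial 10 : ℝ) / β ^ 5 * (2 * Real.exp ζ)

lemma pow_ten_le (β w : ℝ) (hβ : 0 < β) :
    w ^ 10 ≤ (Nat.factorial 10 : ℝ) / β ^ 5 * (Real.exp (√β * w) + Real.exp (√β * -w)) := by
  have h1 := Real.pow_div_factorial_le_exp (x := √β * |w|) (by positivity) 10
  have h2 : (√β * |w|) ^ 10 = β ^ 5 * w ^ 10 := by
    rw [mul_pow, Even.pow_abs (by decide), show (10 : ℕ) = 2 * 5 by norm_num, pow_mul √β,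
      Real.sq_sqrt hβ.le]
  have h3 : Real.exp (√β * |w|) ≤ Real.exp (√β * w) + Real.exp (√β * -w) := by
    rcases abs_choice w with h | h <;> rw [h] <;>
      linarith [Real.exp_pos (√β * w), Real.exp_pos (√β * -w)]
  rw [h2] at h1
  have h4 := h1.trans h3
  rw [div_le_iff₀ (by positivity)] at h4
  rw [div_mul_eq_mul_div, le_div_iff₀ (by positivity)]
  linarith

lemma moment {X : Type*} [MeasurableSpace X] {n : ℕ} (P : Fin n → Measure X)
    [∀ i, MeasureTheory.IsProbabilityMeasure (P i)]
    (g : Fin n → X → ℝ) (hg : ∀ i, Integrable (g i) (P i)) (hg0 : ∀ i, ∫ x, g i x ∂(P i) = 0)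
    (hgm : ∀ i, Measurable (g i))
    (β ζ : ℝ) (h : Fin n → ℝ) (hβ : 0 < β) (hζ0 : 0 < ζ)
    (hh : ∑ i, h i ^ 2 ≤ 1) (hI : ∀ i, Integrable (fun x => Real.exp (β * g i x ^ 2)) (P i))
    (hζ : ∀ i, ∫ x, Real.exp (β * g i x ^ 2) ∂(P i) ≤ ζ) :
    Integrable (fun y : Fin n → X => (∑ i, h i * g i (y i)) ^ 10) (Measure.pi P) ∧
      ∫ y, (∑ i, h i * g i (y i)) ^ 10 ∂(Measure.pi P) ≤ Mu β ζ := by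
  have h1 := exp_prod P g hg hg0 β ζ h hβ hζ0 hh hI hζ
  have h2 := exp_prod P g hg hg0 β ζ (fun i => - h i) hβ hζ0 (by simpa using hh) hI hζ
  have e : ∀ y : Fin n → X, ∑ i, - h i * g i (y i) = - ∑ i, h i * g i (y i) := by
    intro y; simp
  simp only [e] at h2
  have hd := (h1.1.add h2.1).const_mul ((Nat.factorial 10 : ℝ) / β ^ 5)
  have hi : Integrable (fun y : Fin n → X => (∑ i, h i * g i (y i)) ^ 10) (Measure.pi P) := by
    refine hd.mono' ?_ ?_
    · apply Measurable.aestronglyMeasurable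
      fun_prop
    · filter_upwards with y
      rw [Real.norm_eq_abs, abs_of_nonneg (Even.pow_nonneg (by decide) _)]
      exact pow_ten_le β _ hβ
  refine ⟨hi, ?_⟩
  refine (integral_mono hi hd (fun y => pow_ten_le β _ hβ)).trans ?_
  rw [integral_const_mul, integral_add' h1.1 h2.1, Mu]
  refine mul_le_mul_of_nonneg_left ?_ (by positivity)
  linarith [h1.2, h2.2]

/-- extend by zero -/
noncomputable def ext0 {n : ℕ} (f : Fin n → ℝ) (i : ℕ) : ℝ := if h : i < n then f ⟨i, h⟩ else 0

lemma sum_ext0 {n : ℕ} (f : Fin n → ℝ) (h : ℕ → ℝ) (s u : ℕ) (hu : u ≤ n) :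
    ∑ i ∈ Finset.Ico s u, h i * ext0 f i =
      ∑ i : Fin n, (if (i : ℕ) ∈ Finset.Ico s u then h i else 0) * f i := by
  have h1 : ∀ i : Fin n, (if (i : ℕ) ∈ Finset.Ico s u then h i else 0) * f i =
      (fun j : ℕ => if j ∈ Finset.Ico s u then h j * ext0 f j else 0) i := by
    intro i
    by_cases hi : (i : ℕ) ∈ Finset.Ico s u <;> simp [hi, ext0]
  rw [Finset.sum_congr rfl (fun i _ => h1 i), Fin.sum_univ_eq_sum_range
    (fun j : ℕ => if j ∈ Finset.Ico s u then h j * ext0 f j else 0) n, ← Finset.sum_filter]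
  refine Finset.sum_congr ?_ fun _ _ => rfl
  ext j
  simp only [Finset.mem_filter, Finset.mem_range, Finset.mem_Ico]
  omega

lemma sum_ite_sq {n : ℕ} (h : ℕ → ℝ) (s u : ℕ) (hu : u ≤ n) :
    ∑ i : Fin n, (if (i : ℕ) ∈ Finset.Ico s u then h i else 0) ^ 2 =
      ∑ i ∈ Finset.Ico s u, h i ^ 2 := by
  have h1 : ∀ i : Fin n, (if (i : ℕ) ∈ Finset.Ico s u then h i else 0) ^ 2 =
      (fun j : ℕ => if j ∈ Finset.Ico s u then h j ^ 2 else 0) i := by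
    intro i
    by_cases hi : (i : ℕ) ∈ Finset.Ico s u <;> simp [hi]
  rw [Finset.sum_congr rfl (fun i _ => h1 i), Fin.sum_univ_eq_sum_range
    (fun j : ℕ => if j ∈ Finset.Ico s u then h j ^ 2 else 0) n, ← Finset.sum_filter]
  refine Finset.sum_congr ?_ fun _ _ => rfl
  ext j
  simp only [Finset.mem_filter, Finset.mem_range, Finset.mem_Ico]
  omega

lemma R2_int {X : Type*} [MeasurableSpace X] {n : ℕ} (P : Fin n → Measure X)
    [∀ i, MeasureTheory.IsProbabilityMeasure (P i)]
    (g : Fin n → X → ℝ) (hg : ∀ i, Integrable (g i) (P i)) (hg0 : ∀ i, ∫ x, g i x ∂(P i) = 0)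
    (hgm : ∀ i, Measurable (g i))
    (β ζ : ℝ) (hβ : 0 < β) (hζ0 : 0 < ζ)
    (hI : ∀ i, Integrable (fun x => Real.exp (β * g i x ^ 2)) (P i))
    (hζ : ∀ i, ∫ x, Real.exp (β * g i x ^ 2) ∂(P i) ≤ ζ) (M Q : ℕ) :
    Integrable (fun y : Fin n → X => R2 n M Q (ext0 fun i => g i (y i))) (Measure.pi P) ∧
      ∫ y, R2 n M Q (ext0 fun i => g i (y i)) ∂(Measure.pi P) ≤ Q * (1 + 2 * Mu β ζ) := by
  have hMu : 0 ≤ Mu β ζ := by unfold Mu; positivity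
  have hmom : ∀ (s u : ℕ) (h : ℕ → ℝ), u ≤ n → ∑ i ∈ Finset.Ico s u, h i ^ 2 ≤ 1 →
      Integrable (fun y : Fin n → X =>
        (∑ i ∈ Finset.Ico s u, h i * ext0 (fun i => g i (y i)) i) ^ 10) (Measure.pi P) ∧
      ∫ y, (∑ i ∈ Finset.Ico s u, h i * ext0 (fun i => g i (y i)) i) ^ 10 ∂(Measure.pi P)
        ≤ Mu β ζ := by
    intro s u h hu hs
    simp only [sum_ext0 _ h s u hu]
    exact moment P g hg hg0 hgm β ζ _ hβ hζ0 (by rw [sum_ite_sq h s u hu]; exact hs) hI hζ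
  have hbdn : ∀ m q, bd n m q ≤ n := fun m q => min_le_right _ _
  have hT : ∀ q, Integrable (fun y : Fin n → X => tb n M q (ext0 fun i => g i (y i)) ^ 2)
      (Measure.pi P) ∧ ∫ y, tb n M q (ext0 fun i => g i (y i)) ^ 2 ∂(Measure.pi P) ≤
        1 + Mu β ζ := by
    intro q
    have h1 := hmom (bd n M q) (bd n M (q + 1)) _ (hbdn _ _)
      (topw_sq _ _ (bd_mono n M (Nat.le_succ q)))
    have hp : ∀ w : ℝ, w ^ 2 ≤ 1 + w ^ 10 := by
      intro w
      by_cases hw : w ^ 2 ≤ 1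
      · linarith [Even.pow_nonneg (show Even 10 by decide) w]
      · push Not at hw
        have : (w ^ 2) ^ 1 ≤ (w ^ 2) ^ 5 := pow_le_pow_right₀ hw.le (by norm_num)
        rw [← pow_mul, ← pow_mul] at this
        norm_num at this
        linarith
    have hd := (integrable_const (1 : ℝ)).add h1.1
    have hi : Integrable (fun y : Fin n → X => tb n M q (ext0 fun i => g i (y i)) ^ 2)
        (Measure.pi P) := by
      refine hd.mono' ?_ ?_
      · apply Measurable.aestronglyMeasurable
        unfold tb topc
        simp only [sum_ext0 _ (fun _ => _) _ _ (hbdn M (q + 1))]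
        fun_prop
      · filter_upwards with y
        rw [Real.norm_eq_abs, abs_of_nonneg (sq_nonneg _)]
        exact hp _
    refine ⟨hi, ?_⟩
    refine (integral_mono hi hd (fun y => hp _)).trans ?_
    rw [integral_add' (integrable_const _) h1.1]
    simp only [integral_const, probReal_univ, smul_eq_mul, one_mul]
    linarith [h1.2]
  have hH : ∀ m q, Integrable (fun y : Fin n → X => hb n m q (ext0 fun i => g i (y i)) ^ 10)
      (Measure.pi P) ∧ ∫ y, hb n m q (ext0 fun i => g i (y i)) ^ 10 ∂(Measure.pi P) ≤
        Mu β ζ := fun m q =>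
    hmom _ _ _ (hbdn _ _) (haarw_sq _ _ _ (bd_mono n m (Nat.le_succ _))
      (bd_mono n m (Nat.le_succ _)))
  unfold R2
  have i1 : Integrable (fun y : Fin n → X => ∑ q ∈ Finset.range Q,
      tb n M q (ext0 fun i => g i (y i)) ^ 2) (Measure.pi P) :=
    integrable_finsetSum _ fun q _ => (hT q).1
  have i2 : ∀ m, Integrable (fun y : Fin n → X => ∑ q ∈ Finset.range (Q * 2 ^ (M - 1 - m)),
      hb n m q (ext0 fun i => g i (y i)) ^ 10 / ((6 / 5 : ℝ) ^ (M - m)) ^ 8) (Measure.pi P) :=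
    fun m => integrable_finsetSum _ fun q _ => (hH m q).1.div_const _
  have i3 : Integrable (fun y : Fin n → X => ∑ m ∈ Finset.range M,
      ∑ q ∈ Finset.range (Q * 2 ^ (M - 1 - m)),
      hb n m q (ext0 fun i => g i (y i)) ^ 10 / ((6 / 5 : ℝ) ^ (M - m)) ^ 8) (Measure.pi P) :=
    integrable_finsetSum _ fun m _ => i2 m
  refine ⟨i1.add i3, ?_⟩
  rw [integral_add i1 i3, integral_finsetSum _ fun q _ => (hT q).1,
    integral_finsetSum _ fun m _ => i2 m]
  have b1 : ∑ q ∈ Finset.range Q, ∫ y, tb n M q (ext0 fun i => g i (y i)) ^ 2 ∂(Measure.pi P) ≤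
      Q * (1 + Mu β ζ) := by
    refine (Finset.sum_le_card_nsmul _ _ _ fun q _ => (hT q).2).trans ?_
    rw [Finset.card_range, nsmul_eq_mul]
  have b2 : ∀ m ∈ Finset.range M, ∫ y, ∑ q ∈ Finset.range (Q * 2 ^ (M - 1 - m)),
      hb n m q (ext0 fun i => g i (y i)) ^ 10 / ((6 / 5 : ℝ) ^ (M - m)) ^ 8 ∂(Measure.pi P) ≤
      Q * Mu β ζ * ((1 / 2) * (1 / 2 : ℝ) ^ (M - 1 - m)) := by
    intro m hm
    rw [Finset.mem_range] at hm
    rw [integral_finsetSum _ fun q _ => (hH m q).1.div_const _]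
    have hc : ∀ q ∈ Finset.range (Q * 2 ^ (M - 1 - m)),
        ∫ y, hb n m q (ext0 fun i => g i (y i)) ^ 10 / ((6 / 5 : ℝ) ^ (M - m)) ^ 8 ∂(Measure.pi P)
        ≤ Mu β ζ / ((6 / 5 : ℝ) ^ (M - m)) ^ 8 := by
      intro q _
      rw [integral_div]
      exact div_le_div_of_nonneg_right (hH m q).2 (by positivity)
    refine (Finset.sum_le_card_nsmul _ _ _ hc).trans ?_
    rw [Finset.card_range, nsmul_eq_mul]
    obtain ⟨j, hj⟩ : ∃ j, M - 1 - m = j := ⟨_, rfl⟩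
    have hj' : M - m = j + 1 := by omega
    rw [hj, hj']
    have h4 : (4 : ℝ) ^ (j + 1) ≤ ((6 / 5 : ℝ) ^ (j + 1)) ^ 8 := by
      rw [← pow_mul, mul_comm, pow_mul]
      exact pow_le_pow_left₀ (by norm_num) (by norm_num) _
    have h5 : Mu β ζ / ((6 / 5 : ℝ) ^ (j + 1)) ^ 8 ≤ Mu β ζ / 4 ^ (j + 1) :=
      div_le_div_of_nonneg_left hMu (by positivity) h4
    push_cast
    have h6 : (Q : ℝ) * 2 ^ j * (Mu β ζ / 4 ^ (j + 1)) ≤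
        Q * Mu β ζ * ((1 / 2) * (1 / 2 : ℝ) ^ j) := by
      have : (4 : ℝ) ^ (j + 1) = 4 * (2 ^ j * 2 ^ j) := by
        rw [← mul_pow]; norm_num [pow_succ]; ring
      rw [this, one_div_pow]
      have h2j : (0 : ℝ) < 2 ^ j := by positivity
      have : (Q : ℝ) * 2 ^ j * (Mu β ζ / (4 * (2 ^ j * 2 ^ j))) =
        Q * Mu β ζ * ((1 / 4) * (1 / 2 ^ j)) := by field_simp
      rw [this]
      have : 0 ≤ Q * Mu β ζ * (1 / 2 ^ j) := by positivity
      nlinarith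
    refine le_trans ?_ h6
    exact mul_le_mul_of_nonneg_left h5 (by positivity)
  have b3 := Finset.sum_le_sum b2
  rw [← Finset.mul_sum, ← Finset.mul_sum, Finset.sum_range_reflect (fun j => (1 / 2 : ℝ) ^ j)] at b3
  have b4 : ∑ j ∈ Finset.range M, (1 / 2 : ℝ) ^ j ≤ 2 := by
    have := geom_sum_eq (show (1 / 2 : ℝ) ≠ 1 by norm_num) M
    rw [this, div_le_iff_of_neg (by norm_num)]
    have : (0 : ℝ) ≤ (1 / 2) ^ M := by positivity
    linarith
  have b5 : Q * Mu β ζ * ((1 / 2) * ∑ j ∈ Finset.range M, (1 / 2 : ℝ) ^ j) ≤ Q * Mu β ζ * 1 :=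
    mul_le_mul_of_nonneg_left (by linarith) (by positivity)
  linarith

noncomputable def gridp (n i : ℕ) : ℝ := ((min i (n - 1) : ℕ) : ℝ) / ((n : ℝ) - 1)

lemma gridp_design (n : ℕ) (i : Fin n) : gridp n i = design n i := by
  unfold gridp design
  rw [min_eq_left (by have := i.2; omega)]

lemma gridp_mono (n : ℕ) (hn : 2 ≤ n) : Monotone (gridp n) := by
  intro i j hij
  have h : (2 : ℝ) ≤ n := by exact_mod_cast hn
  unfold gridp
  refine div_le_div_of_nonneg_right ?_ (by linarith)
  exact_mod_cast min_le_min_right _ hij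

lemma gridp_mem (n : ℕ) (hn : 2 ≤ n) (i : ℕ) : gridp n i ∈ Set.Icc (0 : ℝ) 1 := by
  have h : (2 : ℝ) ≤ n := by exact_mod_cast hn
  unfold gridp
  refine ⟨div_nonneg (by positivity) (by linarith), ?_⟩
  rw [div_le_one (by linarith)]
  have h1 : min i (n - 1) + 1 ≤ n := by omega
  have h2 : ((min i (n - 1) : ℕ) : ℝ) + 1 ≤ n := by exact_mod_cast h1
  linarith

lemma var_le {E : Type*} [SeminormedAddCommGroup E] (n : ℕ) (hn : 2 ≤ n) (f : ℝ → E)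
    (hf : TV f ≠ ⊤) :
    ∑ l ∈ Finset.range n, ‖f (gridp n (l + 1)) - f (gridp n l)‖ ≤ (TV f).toReal := by
  have h := eVariationOn.sum_le (f := f) (n := n) (gridp_mono n hn) (gridp_mem n hn)
  have h0 : 0 ≤ ∑ l ∈ Finset.range n, ‖f (gridp n (l + 1)) - f (gridp n l)‖ :=
    Finset.sum_nonneg fun _ _ => norm_nonneg _
  rw [← ENNReal.ofReal_le_iff_le_toReal hf, ENNReal.ofReal_sum_of_nonneg fun _ _ => norm_nonneg _]
  simp only [edist_dist, dist_eq_norm] at h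
  exact h

lemma abs_coord_le {k : ℕ} (v : EuclideanSpace ℝ (Fin k)) (c : Fin k) : |v c| ≤ ‖v‖ := by
  have := PiLp.norm_apply_le v c
  simpa using this

lemma core (k n : ℕ) (hn : 2 ≤ n) (M Q : ℕ) (hQ : n ≤ Q * 2 ^ M) (lam : ℝ)
    (f g : ℝ → EuclideanSpace ℝ (Fin k)) (hf : TV f ≠ ⊤) (C : ℝ) (hC : 0 < C)
    (hg : TV g ≤ ENNReal.ofReal C)
    (y : Fin n → EuclideanSpace ℝ (Fin k)) (hL : Lloss k n lam y f ≤ Lloss k n lam y g)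
    (hlam : 12 * k * √(2 ^ M) ≤ n * lam) :
    ∑ i : Fin n, ‖f (design n i) - g (design n i)‖ ^ 2 ≤
      4 * (n * lam) * C + 4 * ∑ c : Fin k, R2 n M Q (ext0 fun i => (y i - g (design n i)) c) := by
  have hgt : TV g ≠ ⊤ := ne_top_of_le_ne_top ENNReal.ofReal_ne_top hg
  have hTg : (TV g).toReal ≤ C := ENNReal.toReal_le_of_le_ofReal hC.le hg
  have hTf0 : 0 ≤ (TV f).toReal := ENNReal.toReal_nonneg
  have hTg0 : 0 ≤ (TV g).toReal := ENNReal.toReal_nonneg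
  have hn0 : (0 : ℝ) < n := by positivity
  set x : Fin k → ℕ → ℝ := fun c i => (f (gridp n i) - g (gridp n i)) c with hx
  set e : Fin k → ℕ → ℝ := fun c => ext0 fun i => (y i - g (design n i)) c with he
  have hxi : ∀ c (i : Fin n), x c i = (f (design n i) - g (design n i)) c := by
    intro c i; simp only [hx, gridp_design]
  have hei : ∀ c (i : Fin n), e c i = (y i - g (design n i)) c := by
    intro c i; simp [he, ext0]
  have hvar : ∀ c, ∑ l ∈ Finset.range n, |x c (l + 1) - x c l| ≤
      (TV f).toReal + (TV g).toReal := by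
    intro c
    refine le_trans ?_ (add_le_add (var_le n hn f hf) (var_le n hn g hgt))
    rw [← Finset.sum_add_distrib]
    refine Finset.sum_le_sum fun l _ => ?_
    have h1 := abs_coord_le (f (gridp n (l + 1)) - f (gridp n l)) c
    have h2 := abs_coord_le (g (gridp n (l + 1)) - g (gridp n l)) c
    have h3 : x c (l + 1) - x c l = (f (gridp n (l + 1)) - f (gridp n l)) c -
        (g (gridp n (l + 1)) - g (gridp n l)) c := by
      simp only [hx, PiLp.sub_apply]; ring
    rw [h3]
    exact (abs_sub _ _).trans (add_le_add h1 h2)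
  have hS : ∑ i : Fin n, ‖f (design n i) - g (design n i)‖ ^ 2 =
      ∑ c, ∑ i ∈ Finset.range n, x c i ^ 2 := by
    simp only [EuclideanSpace.real_norm_sq_eq, Finset.sum_range, hxi]
    rw [Finset.sum_comm]
  have hD : ∑ i : Fin n, ‖f (design n i) - y i‖ ^ 2 - ∑ i : Fin n, ‖g (design n i) - y i‖ ^ 2 =
      ∑ c, ∑ i ∈ Finset.range n, x c i ^ 2 - ∑ c, 2 * ∑ i ∈ Finset.range n, e c i * x c i := by
    simp only [EuclideanSpace.real_norm_sq_eq, Finset.sum_range, hxi, hei]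
    rw [Finset.sum_comm, Finset.sum_comm (f := fun (i : Fin n) (c : Fin k) =>
      ((g (design n i) - y i) c) ^ 2), ← Finset.sum_sub_distrib, ← Finset.sum_sub_distrib]
    refine Finset.sum_congr rfl fun c _ => ?_
    rw [Finset.mul_sum, ← Finset.sum_sub_distrib, ← Finset.sum_sub_distrib]
    refine Finset.sum_congr rfl fun i _ => ?_
    simp only [PiLp.sub_apply]
    ring
  have hB : ∑ i : Fin n, ‖f (design n i) - y i‖ ^ 2 - ∑ i : Fin n, ‖g (design n i) - y i‖ ^ 2 ≤
      n * lam * ((TV g).toReal - (TV f).toReal) := by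
    unfold Lloss at hL
    have h1 := mul_le_mul_of_nonneg_left hL hn0.le
    have hcan : ∀ A : ℝ, (n : ℝ) * (1 / n * A) = A := fun A => by field_simp
    rw [mul_add, mul_add, hcan, hcan] at h1
    linarith
  have hdet : ∑ c, 2 * ∑ i ∈ Finset.range n, e c i * x c i ≤
      ∑ c : Fin k, (12 * √(2 ^ M) * ((TV f).toReal + (TV g).toReal) +
      (∑ i ∈ Finset.range n, x c i ^ 2) / 2 + 2 * R2 n M Q (e c)) := by
    refine Finset.sum_le_sum fun c _ => (det_bound n M Q hQ (e c) (x c)).trans ?_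
    have := mul_le_mul_of_nonneg_left (hvar c) (show 0 ≤ 12 * √((2 : ℝ) ^ M) by positivity)
    linarith
  have hR : ∑ c, 2 * R2 n M Q (e c) = 2 * ∑ c, R2 n M Q (e c) := by rw [Finset.mul_sum]
  rw [Finset.sum_add_distrib, Finset.sum_add_distrib, Finset.sum_const, Finset.card_univ,
    Fintype.card_fin, nsmul_eq_mul, ← Finset.sum_div, hR] at hdet
  rw [hS]
  have h5 := mul_le_mul_of_nonneg_right hlam (add_nonneg hTf0 hTg0)
  have hnl : 0 ≤ n * lam := le_trans (by positivity) hlam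
  have h6 := mul_le_mul_of_nonneg_left hTg hnl
  change _ ≤ 4 * (n * lam) * C + 4 * ∑ c, R2 n M Q (e c)
  linarith

lemma R2_nonneg (n M Q : ℕ) (e : ℕ → ℝ) : 0 ≤ R2 n M Q e := by
  unfold R2
  refine add_nonneg (Finset.sum_nonneg fun _ _ => sq_nonneg _) (Finset.sum_nonneg fun _ _ =>
    Finset.sum_nonneg fun _ _ => div_nonneg (Even.pow_nonneg (by decide) _) (by positivity))

lemma prob_bound (k n : ℕ) (M Q : ℕ) (C β ζ : ℝ) (hβ : 0 < β) (hζ : 0 < ζ)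
    (ν : Measure (Fin n → EuclideanSpace ℝ (Fin k))) (g : ℝ → EuclideanSpace ℝ (Fin k))
    (hF : InFamily k C β ζ n ν g) (a : ℝ) (ha : 0 < a) :
    ν {y | a ≤ ∑ c : Fin k, R2 n M Q (ext0 fun i => (y i - g (design n i)) c)} ≤
      ENNReal.ofReal (k * (Q * (1 + 2 * Mu β ζ)) / a) := by
  obtain ⟨-, νi, rfl, hmean, hexp⟩ := hF
  have hc : ∀ c : Fin k,
      Integrable (fun y : Fin n → EuclideanSpace ℝ (Fin k) =>
        R2 n M Q (ext0 fun i => (y i - g (design n i)) c))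
        (Measure.pi fun i => (νi i : Measure (EuclideanSpace ℝ (Fin k)))) ∧
      ∫ y : Fin n → EuclideanSpace ℝ (Fin k), R2 n M Q (ext0 fun i => (y i - g (design n i)) c)
        ∂(Measure.pi fun i => (νi i : Measure (EuclideanSpace ℝ (Fin k)))) ≤
        Q * (1 + 2 * Mu β ζ) := by
    intro c
    have hint : ∀ i, Integrable (fun v : EuclideanSpace ℝ (Fin k) => (v - g (design n i)) c)
        (νi i : Measure (EuclideanSpace ℝ (Fin k))) := fun i =>
      (EuclideanSpace.proj (𝕜 := ℝ) c).integrable_comp ((hmean i).1.sub (integrable_const _))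
    have hbig : ∀ i, Integrable (fun v : EuclideanSpace ℝ (Fin k) =>
        Real.exp (β * ‖v - g (design n i)‖ ^ 2)) (νi i : Measure (EuclideanSpace ℝ (Fin k))) := by
      intro i
      refine ⟨by fun_prop, ?_⟩
      rw [hasFiniteIntegral_iff_ofReal (Filter.Eventually.of_forall fun v => (Real.exp_pos _).le)]
      exact (hexp i).trans_lt ENNReal.ofReal_lt_top
    have hle : ∀ i (v : EuclideanSpace ℝ (Fin k)),
        Real.exp (β * ((v - g (design n i)) c) ^ 2) ≤ Real.exp (β * ‖v - g (design n i)‖ ^ 2) := by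
      intro i v
      refine Real.exp_le_exp.mpr (mul_le_mul_of_nonneg_left ?_ hβ.le)
      rw [← sq_abs]
      exact pow_le_pow_left₀ (abs_nonneg _) (abs_coord_le _ c) 2
    have hsm : ∀ i, Integrable (fun v : EuclideanSpace ℝ (Fin k) =>
        Real.exp (β * ((v - g (design n i)) c) ^ 2))
        (νi i : Measure (EuclideanSpace ℝ (Fin k))) := by
      intro i
      refine (hbig i).mono' ?_ ?_
      · exact Real.continuous_exp.comp_aestronglyMeasurable
          (((hint i).aestronglyMeasurable.pow 2).const_mul _)
      · filter_upwards with v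
        rw [Real.norm_eq_abs, abs_of_pos (Real.exp_pos _)]
        exact hle i v
    refine R2_int (fun i => (νi i : Measure (EuclideanSpace ℝ (Fin k))))
      (fun i v => (v - g (design n i)) c) hint ?_ ?_ β ζ hβ hζ hsm ?_ M Q
    · intro i
      have h1 := (EuclideanSpace.proj (𝕜 := ℝ) c).integral_comp_comm
        ((hmean i).1.sub (integrable_const (g (design n i))))
      have h2 : ∫ v : EuclideanSpace ℝ (Fin k), (v - g (design n i))
          ∂(νi i : Measure (EuclideanSpace ℝ (Fin k))) = 0 := by
        rw [integral_sub (hmean i).1 (integrable_const _), (hmean i).2]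
        simp
      have h3 : ((fun y : EuclideanSpace ℝ (Fin k) => y) - fun _ => g (design n i)) =
        fun v => v - g (design n i) := rfl
      rw [h3, h2] at h1
      simpa using h1
    · intro i
      exact ((EuclideanSpace.proj (𝕜 := ℝ) c).continuous.comp
        (continuous_id.sub continuous_const)).measurable
    · intro i
      refine (integral_mono (hsm i) (hbig i) (hle i)).trans ?_
      have h1 := ofReal_integral_eq_lintegral_ofReal (hbig i)
        (Filter.Eventually.of_forall fun v => (Real.exp_pos _).le)
      have h2 := hexp i
      rw [← h1] at h2
      exact (ENNReal.ofReal_le_ofReal_iff hζ.le).mp h2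
  have hI := integrable_finsetSum (Finset.univ : Finset (Fin k)) fun c _ => (hc c).1
  have hM := mul_meas_ge_le_integral_of_nonneg
    (Filter.Eventually.of_forall fun y => Finset.sum_nonneg fun c _ => R2_nonneg _ _ _ _) hI a
  rw [integral_finsetSum _ fun c _ => (hc c).1] at hM
  have hM2 := hM.trans (Finset.sum_le_card_nsmul _ _ _ fun c _ => (hc c).2)
  rw [Finset.card_univ, Fintype.card_fin, nsmul_eq_mul, mul_comm, ← le_div_iff₀ ha] at hM2
  rw [← ofReal_measureReal]
  exact ENNReal.ofReal_le_ofReal hM2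

lemma pointwise (k : ℕ) (hk : 1 ≤ k) (C β ζ c₁ c₂ : ℝ)
    (hC : 0 < C) (hβ : 0 < β) (hζ : 0 < ζ) (hc₁ : 0 < c₁) (n : ℕ) (hn : 2 ≤ n)
    (a : ℝ) (ha : 0 < a) (ha3 : a ^ 3 = n) (lam : ℝ) (h1 : c₁ * a ≤ n * lam)
    (h2 : n * lam ≤ c₂ * a) (γ : ℝ) (hγ : 0 < γ) (hγ1 : γ ≤ 1)
    (hγ2 : γ ≤ (c₁ / (12 * k)) ^ 2) (hbig : 1 ≤ γ * a ^ 2)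
    (est : (Fin n → EuclideanSpace ℝ (Fin k)) → ℝ → EuclideanSpace ℝ (Fin k))
    (hest : ∀ y : Fin n → EuclideanSpace ℝ (Fin k),
      TV (est y) ≠ ⊤ ∧
        ∀ g : ℝ → EuclideanSpace ℝ (Fin k), TV g ≠ ⊤ →
          Lloss k n lam y (est y) ≤ Lloss k n lam y g)
    (D : ℝ) (hD : 0 < D) (hD2 : 8 * c₂ * C ≤ D ^ 2)
    (ν : Measure (Fin n → EuclideanSpace ℝ (Fin k))) (g : ℝ → EuclideanSpace ℝ (Fin k))
    (hF : InFamily k C β ζ n ν g) :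
    ν {y | dn k n (est y) g > D * a⁻¹} ≤
      ENNReal.ofReal (32 * k * (1 + 2 * Mu β ζ) / γ / D ^ 2) := by
  obtain ⟨M, hM1, hM2⟩ := exists_nat_pow_near hbig (one_lt_two)
  have hk0 : (0 : ℝ) < k := by exact_mod_cast hk
  have hp : (0 : ℝ) < 2 ^ M := by positivity
  have hn0 : (0 : ℝ) < n := by positivity
  have hMu : 0 ≤ Mu β ζ := by unfold Mu; positivity
  have hs : 12 * k * √(2 ^ M) ≤ n * lam := by
    refine le_trans ?_ h1
    have : √((2 : ℝ) ^ M) ≤ c₁ / (12 * k) * a := by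
      apply Real.sqrt_le_iff.2
      refine ⟨by positivity, hM1.trans ?_⟩
      rw [mul_pow]
      gcongr
    calc 12 * k * √((2 : ℝ) ^ M) ≤ 12 * k * (c₁ / (12 * k) * a) := by gcongr
      _ = c₁ * a := by field_simp
  have ha1 : 1 ≤ a := by
    by_contra h
    push Not at h
    have : γ * a ^ 2 < 1 := by
      calc γ * a ^ 2 ≤ 1 * a ^ 2 := by gcongr
        _ < 1 := by nlinarith
    linarith
  have hpn : (2 : ℝ) ^ M ≤ n := by
    rw [← ha3]
    calc (2 : ℝ) ^ M ≤ γ * a ^ 2 := hM1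
      _ ≤ 1 * a ^ 2 := by gcongr
      _ ≤ a ^ 3 := by nlinarith [sq_nonneg a]
  set Q := n / 2 ^ M + 1 with hQdef
  have hQ : n ≤ Q * 2 ^ M := by
    have := Nat.lt_div_mul_add (a := n) (b := 2 ^ M) (by positivity)
    rw [hQdef, add_mul, one_mul]
    exact this.le
  have hQ2 : (Q : ℝ) ≤ 4 * a / γ := by
    have e1 : ((n / 2 ^ M : ℕ) : ℝ) ≤ n / 2 ^ M := by
      have := Nat.cast_div_le (α := ℝ) (m := n) (n := 2 ^ M)
      simpa using this
    have e2 : (1 : ℝ) ≤ n / 2 ^ M := by rwa [le_div_iff₀ hp, one_mul]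
    have e3 : (n : ℝ) / 2 ^ M ≤ 2 * a / γ := by
      rw [div_le_div_iff₀ hp hγ, ← ha3]
      rw [pow_succ 2 M] at hM2
      have := mul_le_mul_of_nonneg_left hM2.le ha.le
      nlinarith
    have e4 : 4 * a / γ = 2 * (2 * a / γ) := by ring
    rw [hQdef]; push_cast
    linarith
  have hgt : TV g ≠ ⊤ := ne_top_of_le_ne_top ENNReal.ofReal_ne_top hF.1
  have hsub : {y | dn k n (est y) g > D * a⁻¹} ⊆
      {y | a * D ^ 2 / 8 ≤ ∑ c : Fin k, R2 n M Q (ext0 fun i => (y i - g (design n i)) c)} := by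
    intro y hy
    have hy' : D * a⁻¹ < dn k n (est y) g := hy
    have hc := core k n hn M Q hQ lam (est y) g (hest y).1 C hC hF.1 y ((hest y).2 g hgt) hs
    unfold dn at hy'
    rw [Real.lt_sqrt (by positivity)] at hy'
    have h3 : a * D ^ 2 < ∑ i : Fin n, ‖est y (design n i) - g (design n i)‖ ^ 2 := by
      rw [one_div, inv_mul_eq_div, lt_div_iff₀ hn0, ← ha3] at hy'
      have : (D * a⁻¹) ^ 2 * a ^ 3 = a * D ^ 2 := by field_simp
      linarith
    have h4 : n * lam * C ≤ c₂ * a * C := by gcongr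
    have h5 := mul_le_mul_of_nonneg_left hD2 ha.le
    show a * D ^ 2 / 8 ≤ _
    linarith
  refine (measure_mono hsub).trans
    ((prob_bound k n M Q C β ζ hβ hζ ν g hF _ (by positivity)).trans ?_)
  apply ENNReal.ofReal_le_ofReal
  calc (k : ℝ) * (Q * (1 + 2 * Mu β ζ)) / (a * D ^ 2 / 8)
      ≤ k * (4 * a / γ * (1 + 2 * Mu β ζ)) / (a * D ^ 2 / 8) := by gcongr
    _ = _ := by field_simp; ring
/-- Euclidean instance of the main rate theorem.  For equispaced designs,
tuning parameters `λ_n ≍ n^{-2/3}`, and any selection `μ̂_n` of minimizers of the total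
variation penalized loss, the estimator converges at the uniform rate `n^{-1/3}` over
the family `ℱ_n`:
`lim_{D→∞} limsup_{n→∞} sup_{F ∈ ℱ_n} P_F(d_n(μ̂_n, μ) > D n^{-1/3}) = 0`. -/
theorem euclidean_rate_theorem (k : ℕ) (hk : 1 ≤ k) (C β ζ c₁ c₂ : ℝ)
    (hC : 0 < C) (hβ : 0 < β) (hζ : 0 < ζ) (hc₁ : 0 < c₁) (hc₁₂ : c₁ ≤ c₂)
    (lam : ℕ → ℝ)
    (hlam : ∀ n : ℕ, 2 ≤ n →
      c₁ * (n : ℝ) ^ (-(2 : ℝ) / 3) ≤ lam n ∧ lam n ≤ c₂ * (n : ℝ) ^ (-(2 : ℝ) / 3))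
    (μhat : (n : ℕ) → (Fin n → EuclideanSpace ℝ (Fin k)) → ℝ → EuclideanSpace ℝ (Fin k))
    (hμhat : ∀ n : ℕ, 2 ≤ n → ∀ y : Fin n → EuclideanSpace ℝ (Fin k),
      TV (μhat n y) ≠ ⊤ ∧
        ∀ g : ℝ → EuclideanSpace ℝ (Fin k), TV g ≠ ⊤ →
          Lloss k n (lam n) y (μhat n y) ≤ Lloss k n (lam n) y g) :
    Tendsto
      (fun D : ℝ =>
        Filter.limsup
          (fun n : ℕ =>
            ⨆ F : {q : Measure (Fin n → EuclideanSpace ℝ (Fin k)) ×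
                (ℝ → EuclideanSpace ℝ (Fin k)) // InFamily k C β ζ n q.1 q.2},
              F.1.1 {y | dn k n (μhat n y) F.1.2 > D * (n : ℝ) ^ (-(1 : ℝ) / 3)})
          atTop)
      atTop (nhds (0 : ℝ≥0∞)) := by
  have hk0 : (0 : ℝ) < k := by exact_mod_cast hk
  set γ : ℝ := min 1 ((c₁ / (12 * k)) ^ 2) with hγdef
  have hγ : 0 < γ := lt_min one_pos (by positivity)
  have hlim : Tendsto (fun D : ℝ => ENNReal.ofReal (32 * k * (1 + 2 * Mu β ζ) / γ / D ^ 2))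
      atTop (nhds 0) := by
    rw [← ENNReal.ofReal_zero]
    apply ENNReal.tendsto_ofReal
    exact tendsto_const_nhds.div_atTop (tendsto_pow_atTop two_ne_zero)
  refine tendsto_of_tendsto_of_tendsto_of_le_of_le' tendsto_const_nhds hlim
    (Eventually.of_forall fun _ => zero_le) ?_
  have hDl : ∀ᶠ D : ℝ in atTop, 8 * c₂ * C ≤ D ^ 2 :=
    (tendsto_pow_atTop (α := ℝ) two_ne_zero).eventually_ge_atTop _
  filter_upwards [hDl, eventually_gt_atTop 0] with D hD2 hD
  refine Filter.limsup_le_of_le (by isBoundedDefault) ?_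
  have hnl : ∀ᶠ n : ℕ in atTop, γ⁻¹ ≤ ((n : ℝ) ^ ((1 : ℝ) / 3)) ^ 2 :=
    ((tendsto_pow_atTop (α := ℝ) two_ne_zero).comp
      ((tendsto_rpow_atTop (show (0 : ℝ) < 1 / 3 by norm_num)).comp
        tendsto_natCast_atTop_atTop)).eventually_ge_atTop _
  filter_upwards [hnl, eventually_ge_atTop 2] with n hn1 hn
  refine iSup_le fun F => ?_
  have hn0 : (0 : ℝ) < n := by positivity
  set a : ℝ := (n : ℝ) ^ ((1 : ℝ) / 3) with hadef
  have ha : 0 < a := Real.rpow_pos_of_pos hn0 _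
  have ha3 : a ^ 3 = n := by
    rw [hadef, ← Real.rpow_natCast, ← Real.rpow_mul hn0.le]
    norm_num
  have hinv : (n : ℝ) ^ (-(1 : ℝ) / 3) = a⁻¹ := by
    rw [hadef, ← Real.rpow_neg hn0.le]
    norm_num
  have hna : (n : ℝ) * (n : ℝ) ^ (-(2 : ℝ) / 3) = a := by
    nth_rewrite 1 [← Real.rpow_one (n : ℝ)]
    rw [hadef, ← Real.rpow_add hn0]
    norm_num
  obtain ⟨hl1, hl2⟩ := hlam n hn
  have h1 := mul_le_mul_of_nonneg_left hl1 hn0.le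
  have h2 := mul_le_mul_of_nonneg_left hl2 hn0.le
  rw [mul_left_comm, hna] at h1 h2
  rw [hinv]
  have hbig : 1 ≤ γ * a ^ 2 := by
    have := mul_le_mul_of_nonneg_left hn1 hγ.le
    rwa [mul_inv_cancel₀ hγ.ne'] at this
  exact pointwise k hk C β ζ c₁ c₂ hC hβ hζ hc₁ n hn a ha ha3 (lam n) h1 h2 γ hγ
    (min_le_left _ _) (min_le_right _ _) hbig (μhat n) (hμhat n hn) D hD hD2 F.1.1 F.1.2 F.2
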